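/- There exists a constant C such that for every prime p and every real number X ≥ 1, the number of pairs (A,B) ∈ ℤ × ℤ satisfying: (i) 4A³ + 27B² ≠ 0, (ii) for every prime q it is not the case that both q⁴ divides A and q⁶ divides B, (iii) max(4|A|³, 27B²) < X, and (iv) p² divides −16(4A³ + 27B²), is at most C·X^{5/6}/p^{4/3}. -/

import Mathlib

section forms
variable {R : Type*} [CommRing R]

/-- binary cubic form -/
def cub (a b c d x y : R) : R := a*x^3 + b*x^2*y + c*x*y^2 + d*y^3
/-- Hessian covariant -/
def hes (a b c d x y : R) : R := (b^2-3*a*c)*x^2 + (b*c-9*a*d)*x*y + (c^2-3*b*d)*y^2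
/-- cubic covariant -/
def jac (a b c d x y : R) : R :=
  (2*(b^2-3*a*c)*x + (b*c-9*a*d)*y) * (b*x^2+2*c*x*y+3*d*y^2)
  - ((b*c-9*a*d)*x + 2*(c^2-3*b*d)*y) * (3*a*x^2+2*b*x*y+c*y^2)
/-- discriminant -/
def dsc (a b c d : R) : R := b^2*c^2-4*a*c^3-4*b^3*d-27*a^2*d^2+18*a*b*c*d
/-- second coefficient of the transformed form -/
def tb (a b c d m n r s : R) : R :=
  3*a*m^2*r + b*(m^2*s+2*m*n*r) + c*(2*m*n*s+n^2*r) + 3*d*n^2*s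

lemma cub_tr (a b c d m n r s x y : R) :
    cub (cub a b c d m n) (tb a b c d m n r s) (tb a b c d r s m n) (cub a b c d r s) x y
      = cub a b c d (m*x+r*y) (n*x+s*y) := by
  simp only [cub, tb]; ring

lemma hes_tr (a b c d m n r s x y : R) :
    hes (cub a b c d m n) (tb a b c d m n r s) (tb a b c d r s m n) (cub a b c d r s) x y
      = (m*s-n*r)^2 * hes a b c d (m*x+r*y) (n*x+s*y) := by
  simp only [cub, tb, hes]; ring

lemma dsc_tr (a b c d m n r s : R) :
    dsc (cub a b c d m n) (tb a b c d m n r s) (tb a b c d r s m n) (cub a b c d r s)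
      = (m*s-n*r)^6 * dsc a b c d := by
  simp only [cub, tb, dsc]; ring

lemma jac_tr (a b c d m n r s x y : R) :
    jac (cub a b c d m n) (tb a b c d m n r s) (tb a b c d r s m n) (cub a b c d r s) x y
      = (m*s-n*r)^3 * jac a b c d (m*x+r*y) (n*x+s*y) := by
  simp only [cub, tb, jac]; ring

lemma syz (a b c d x y : R) :
    (jac a b c d x y)^2 + 27 * dsc a b c d * (cub a b c d x y)^2 = 4 * (hes a b c d x y)^3 := by
  simp only [cub, jac, hes, dsc]; ring
end forms

/-- the properties of the positive definite quadratic form attached to a real cubic form -/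
def QP (a b c d α β γ : ℝ) : Prop :=
  |dsc a b c d| ≤ 4*α*γ-β^2 ∧ 4*α*γ-β^2 ≤ 3*|dsc a b c d| ∧
  ∀ x y : ℝ, |hes a b c d x y| ≤ 3*(α*x^2+β*x*y+γ*y^2) ∧
    |dsc a b c d| * (cub a b c d x y)^2 ≤ 4*(α*x^2+β*x*y+γ*y^2)^3 ∧
    ∀ Z : ℝ, 0 ≤ Z → |hes a b c d x y| ≤ 3*Z^2 → |jac a b c d x y| ≤ 27*Z^3 →
      α*x^2+β*x*y+γ*y^2 ≤ 13*Z^2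

lemma root_exists (A B : ℝ) : ∃ θ : ℝ, θ^3+A*θ+B = 0 := by
  set N := 1+|A|+|B| with hN
  have h1 := abs_nonneg A
  have h2 := abs_nonneg B
  have h3 := neg_abs_le A
  have h4 := neg_abs_le B
  have h5 := le_abs_self A
  have h6 := le_abs_self B
  have hc : ContinuousOn (fun θ : ℝ => θ^3+A*θ+B) (Set.Icc (-N) N) := by fun_prop
  have hN1 : 1 ≤ N := by linarith
  have hAN : |A| + |B| ≤ N^2 := by nlinarith
  have e1 : |A| * N+|B| ≤ N^3 := by nlinarith
  have e2 : |A*N| = |A| * N := by rw [abs_mul, abs_of_nonneg (by linarith : 0 ≤ N)]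
  have e3 := neg_abs_le (A*N)
  have e4 := le_abs_self (A*N)
  have := intermediate_value_Icc (by linarith : -N ≤ N) hc
  obtain ⟨θ, _, h⟩ := this (show (0:ℝ) ∈ _ from ⟨by nlinarith, by nlinarith⟩)
  exact ⟨θ, h⟩

lemma root_bound (A B θ Z : ℝ) (hZ : 0 ≤ Z) (hA : |A| ≤ Z^2) (hB : |B| ≤ Z^3)
    (h : θ^3+A*θ+B = 0) : θ^2 ≤ 4*Z^2 := by
  by_contra hc
  push Not at hc
  have h0 : 2*Z < |θ| := by
    apply lt_of_pow_lt_pow_left₀ 2 (abs_nonneg _)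
    rw [sq_abs]; nlinarith
  have h1 : |θ|^3 = |A*θ+B| := by
    rw [← abs_pow, ← abs_neg (A*θ+B)]; congr 1; linarith
  have h2 : |A*θ+B| ≤ |A| * |θ|+|B| := by
    rw [← abs_mul]; exact abs_add_le _ _
  have h3 : |A| * |θ| ≤ Z^2*|θ| := by gcongr
  have h4 : |θ|^2 = θ^2 := sq_abs _
  have h5 : |θ|^3 = θ^2*|θ| := by rw [← h4]; ring
  have h6 : 0 < |θ| := by linarith
  have h7 : 4*Z^2*|θ| < θ^2*|θ| := by gcongr
  have h8 : Z^2*(2*Z) ≤ Z^2*|θ| := by gcongr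
  have h9 : 0 ≤ Z^3 := by positivity
  nlinarith [mul_nonneg (sq_nonneg Z) h6.le]

lemma QP_dep (A B : ℝ) (hD : dsc 1 0 A B ≠ 0) : ∃ α β γ, QP 1 0 A B α β γ := by
  rcases lt_or_gt_of_ne hD with hD | hD
  · obtain ⟨θ, hθ⟩ := root_exists A B
    have hB : B = -θ^3-A*θ := by linarith
    have hd : dsc 1 0 A B = -((3*θ^2+4*A)*(3*θ^2+A)^2) := by
      rw [hB]; simp only [dsc]; ring
    have hη : 0 < 3*θ^2+4*A := by
      by_contra hc
      push Not at hc
      have := mul_nonpos_of_nonpos_of_nonneg hc (sq_nonneg (3*θ^2+A))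
      linarith
    have hM : 0 < 3*θ^2+A := by nlinarith [sq_nonneg θ]
    set M := 3*θ^2+A with hMdef
    have habs : |dsc 1 0 A B| = (3*θ^2+4*A)*M^2 := by
      rw [hd, abs_neg, abs_of_nonneg (by positivity)]
    refine ⟨M, M*θ, M*(θ^2+A), ?_, ?_, ?_⟩
    · rw [habs]; nlinarith
    · rw [habs]; nlinarith [mul_pos hη (pow_pos hM 2)]
    · intro x y
      set q := x^2+θ*x*y+(θ^2+A)*y^2 with hq
      have hQ : M*x^2+M*θ*x*y+M*(θ^2+A)*y^2 = M*q := by rw [hq]; ring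
      rw [hQ]
      set T := θ*x+(θ^2+2*A/3)*y with hT
      have i1 : hes 1 0 A B x y = -3*(M*q-3*T^2) := by
        rw [hq, hT, hB, hMdef]; simp only [hes]; ring
      have i2 : 4/3*(M*q) - 3*T^2 = (3*θ^2+4*A)/3*(x-θ*y)^2 := by
        rw [hq, hT, hMdef]; ring
      have i3 : T^3 + (-hes 1 0 A B x y/3)*T + jac 1 0 A B x y/27 = 0 := by
        rw [hT, hB]; simp only [hes, jac]; ring
      have i4 : cub 1 0 A B x y = (x-θ*y)*q := by
        rw [hq, hB]; simp only [cub]; ring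
      have p1 : 0 ≤ (3*θ^2+4*A)/3*(x-θ*y)^2 := by positivity
      have p2 := sq_nonneg T
      have hq0 : 0 ≤ q := by
        have : 4*q = (2*x+θ*y)^2 + (3*θ^2+4*A)*y^2 := by rw [hq]; ring
        have : 0 ≤ 4*q := by rw [this]; positivity
        linarith
      have hMq : 0 ≤ M*q := by positivity
      refine ⟨?_, ?_, ?_⟩
      · rw [i1, abs_le]; constructor <;> nlinarith
      · rw [habs, i4]
        have : (3*θ^2+4*A)*(x-θ*y)^2 ≤ 4*(M*q) := by nlinarith
        calc (3*θ^2+4*A)*M^2*((x-θ*y)*q)^2 = ((3*θ^2+4*A)*(x-θ*y)^2)*(M*q)^2 := by ring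
          _ ≤ 4*(M*q)*(M*q)^2 := by gcongr
          _ = _ := by ring
      · intro Z hZ h1 h2
        have := root_bound (-hes 1 0 A B x y/3) (jac 1 0 A B x y/27) T Z hZ
          (by rw [abs_div, abs_neg, abs_of_pos (by norm_num : (0:ℝ)<3)]; linarith)
          (by rw [abs_div, abs_of_pos (by norm_num : (0:ℝ)<27)]; linarith) i3
        have h3 := neg_abs_le (hes 1 0 A B x y)
        linarith
  · have hd : dsc 1 0 A B = -(4*A^3+27*B^2) := by simp only [dsc]; ring
    have hA : A < 0 := by
      by_contra hc
      push Not at hc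
      have : 0 ≤ 4*A^3+27*B^2 := by positivity
      linarith
    refine ⟨-3*A, -9*B, A^2, ?_, ?_, ?_⟩
    · rw [abs_of_pos hD]; nlinarith
    · rw [abs_of_pos hD]; nlinarith
    · intro x y
      have hQ : -3*A*x^2 + -9*B*x*y+A^2*y^2 = hes 1 0 A B x y := by simp only [hes]; ring
      rw [hQ]
      have hp : 0 ≤ hes 1 0 A B x y := by
        have : (-12*A)*hes 1 0 A B x y = (6*A*x+9*B*y)^2+3*dsc 1 0 A B*y^2 := by
          simp only [hes, dsc]; ring
        have h2 : 0 ≤ (-12*A)*hes 1 0 A B x y := by rw [this]; positivity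
        exact nonneg_of_mul_nonneg_right h2 (by linarith)
      refine ⟨?_, ?_, ?_⟩
      · rw [abs_of_nonneg hp]; linarith
      · rw [abs_of_pos hD]
        have := syz 1 0 A B x y
        nlinarith [sq_nonneg (jac 1 0 A B x y), mul_nonneg hD.le (sq_nonneg (cub 1 0 A B x y))]
      · intro Z hZ h1 _
        rw [abs_of_nonneg hp] at h1
        nlinarith [sq_nonneg Z]

lemma QP_lead (a b c d : ℝ) (ha : a ≠ 0) (hD : dsc a b c d ≠ 0) :
    ∃ α β γ, QP a b c d α β γ := by
  set A := -3*(b^2-3*a*c) with hA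
  set B := 2*b^3-9*a*b*c+27*a^2*d with hB
  have ed : dsc 1 0 A B = 729*a^2*dsc a b c d := by
    rw [hA, hB]; simp only [dsc]; ring
  have eh : ∀ x y, hes 1 0 A B (3*a*x+b*y) y = 81*a^2*hes a b c d x y := by
    intro x y; rw [hA, hB]; simp only [hes]; ring
  have ej : ∀ x y, jac 1 0 A B (3*a*x+b*y) y = 729*a^3*jac a b c d x y := by
    intro x y; rw [hA, hB]; simp only [jac]; ring
  have ec : ∀ x y, cub 1 0 A B (3*a*x+b*y) y = 27*a^2*cub a b c d x y := by
    intro x y; rw [hA, hB]; simp only [cub]; ring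
  have ha2 : 0 < a^2 := by positivity
  obtain ⟨α, β, γ, h1, h2, h3⟩ := QP_dep A B (by rw [ed]; positivity)
  rw [ed, abs_mul, abs_of_pos (by positivity : 0 < 729*a^2)] at h1 h2
  have key : ∀ x y : ℝ, α*(3*a*x+b*y)^2+β*(3*a*x+b*y)*y+γ*y^2 = 81*a^2*
      (α/9*x^2+ (6*a*b*α+3*a*β)/(81*a^2)*x*y + (α*b^2+β*b+γ)/(81*a^2)*y^2) := by
    intro x y; field_simp; ring
  have kd : 4*(α/9)*((α*b^2+β*b+γ)/(81*a^2)) - ((6*a*b*α+3*a*β)/(81*a^2))^2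
      = (4*α*γ-β^2)/(729*a^2) := by field_simp; ring
  refine ⟨α/9, (6*a*b*α+3*a*β)/(81*a^2), (α*b^2+β*b+γ)/(81*a^2), ?_, ?_, ?_⟩
  · rw [kd, le_div_iff₀ (by positivity)]; linarith
  · rw [kd, div_le_iff₀ (by positivity)]; linarith
  · intro x y
    obtain ⟨g1, g2, g3⟩ := h3 (3*a*x+b*y) y
    rw [key, eh] at g1
    rw [key, ed, ec] at g2
    rw [key, eh, ej] at g3
    set Q := α/9*x^2+ (6*a*b*α+3*a*β)/(81*a^2)*x*y + (α*b^2+β*b+γ)/(81*a^2)*y^2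
    rw [abs_mul, abs_of_pos (by positivity : 0 < 81*a^2)] at g1 g3
    rw [abs_mul, abs_of_pos (by positivity : 0 < 729*a^2)] at g2
    refine ⟨?_, ?_, ?_⟩
    · have : (81*a^2)*|hes a b c d x y| ≤ (81*a^2)*(3*Q) := by linarith
      exact le_of_mul_le_mul_left this (by positivity)
    · have : (531441*a^6)*(|dsc a b c d| * (cub a b c d x y)^2) ≤ (531441*a^6)*(4*Q^3) := by
        linarith
      exact le_of_mul_le_mul_left this (by positivity)
    · intro Z hZ k1 k2
      have e2 : |a|^2 = a^2 := sq_abs a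
      have e3 : |a|^3 = |a^3| := (abs_pow a 3).symm
      have := g3 (9 * |a| * Z) (by positivity)
        (by
          have : 3*(9 * |a| * Z)^2 = 81*a^2*(3*Z^2) := by rw [← e2]; ring
          rw [this]; gcongr)
        (by
          have : 27*(9 * |a| * Z)^3 = 729 * |a|^3 * (27*Z^3) := by ring
          rw [this, abs_mul, abs_mul, ← e3, abs_of_pos (by norm_num : (0:ℝ) < 729)]; gcongr)
      have h : (81*a^2)*Q ≤ (81*a^2)*(13*Z^2) := by
        have e : 13*(9 * |a| * Z)^2 = (81*a^2)*(13*Z^2) := by rw [← e2]; ring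
        linarith
      exact le_of_mul_le_mul_left h (by positivity)

lemma reduce (α β γ : ℝ) (hα : 0 < α) (hΔ : 0 < 4*α*γ-β^2) :
    ∃ m n : ℤ, IsCoprime m n ∧ (α*m^2+β*m*n+γ*n^2)^2 ≤ 4*α*γ-β^2 := by
  set Δ := 4*α*γ-β^2 with hD
  set w := Real.sqrt Δ with hw
  have hw0 : 0 < w := Real.sqrt_pos.mpr hΔ
  have hw2 : w^2 = Δ := Real.sq_sqrt hΔ.le
  by_cases h : 2*α < w
  · refine ⟨1, 0, isCoprime_one_left, ?_⟩
    push_cast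
    rw [← hw2]
    nlinarith
  · push Not at h
    set N := ⌊Real.sqrt (2*α/w)⌋₊ with hN
    have h1 : 1 ≤ 2*α/w := by rw [le_div_iff₀ hw0]; linarith
    have hs1 : 1 ≤ Real.sqrt (2*α/w) := by rw [Real.one_le_sqrt]; exact h1
    have hs2 : Real.sqrt (2*α/w)^2 = 2*α/w := Real.sq_sqrt (by linarith)
    have hN1 : 0 < N := Nat.floor_pos.mpr hs1
    have hNle : (N:ℝ) ≤ Real.sqrt (2*α/w) := Nat.floor_le (by linarith)
    have hNlt : Real.sqrt (2*α/w) < N+1 := Nat.lt_floor_add_one _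
    obtain ⟨q, hq, hqd⟩ := Real.exists_rat_abs_sub_le_and_den_le (-β/(2*α)) hN1
    have hd0 : (0:ℝ) < q.den := by exact_mod_cast q.den_pos
    refine ⟨q.num, q.den, ?_, ?_⟩
    · rw [Int.isCoprime_iff_gcd_eq_one]; simpa [Int.gcd] using q.reduced
    have hqq : (q:ℝ) = q.num / q.den := by exact_mod_cast (Rat.num_div_den q).symm
    push_cast
    set m : ℝ := (q.num:ℝ)
    set n : ℝ := (q.den:ℝ)
    have hnN : n ≤ N := Nat.cast_le.mpr hqd
    have e1 : |2*α*m+β*n| ≤ 2*α/(N+1) := by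
      have : 2*α*m+β*n = -(2*α*n)*(-β/(2*α) - q) := by rw [hqq]; field_simp; ring
      rw [this, abs_mul, abs_neg, abs_of_pos (by positivity : 0 < 2*α*n)]
      calc 2*α*n * |-β/(2*α) - q| ≤ 2*α*n*(1/((N+1)*n)) := by gcongr
        _ = _ := by field_simp
    have e2 : (2*α*m+β*n)^2 ≤ 2*α*w := by
      rw [← sq_abs]
      calc |2*α*m+β*n|^2 ≤ (2*α/(N+1))^2 := by gcongr
        _ ≤ (2*α/Real.sqrt (2*α/w))^2 := by gcongr
        _ = 2*α*w := by rw [div_pow, hs2]; field_simp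
    have e3 : Δ*n^2 ≤ 2*α*w := by
      calc Δ*n^2 ≤ Δ*Real.sqrt (2*α/w)^2 := by gcongr; linarith
        _ = 2*α*w := by rw [hs2, ← hw2]; field_simp
    have e4 : 4*α*(α*m^2+β*m*n+γ*n^2) = (2*α*m+β*n)^2+Δ*n^2 := by rw [hD]; ring
    have e5 : 4*α*(α*m^2+β*m*n+γ*n^2) ≤ 4*α*w := by linarith
    have e6 : α*m^2+β*m*n+γ*n^2 ≤ w := le_of_mul_le_mul_left e5 (by positivity)
    have e7 : 0 ≤ 4*α*(α*m^2+β*m*n+γ*n^2) := by rw [e4]; positivity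
    have e8 : 0 ≤ α*m^2+β*m*n+γ*n^2 := nonneg_of_mul_nonneg_right e7 (by positivity)
    rw [← hw2]; gcongr

/-- transporting the quadratic form along an invertible substitution -/
lemma QP_gen (a b c d m n r s : ℝ) (hdet : m*s-n*r = 1) (ha : cub a b c d m n ≠ 0)
    (hD : dsc a b c d ≠ 0) : ∃ α β γ, QP a b c d α β γ := by
  obtain ⟨α, β, γ, h1, h2, h3⟩ := QP_lead (cub a b c d m n) (tb a b c d m n r s)
    (tb a b c d r s m n) (cub a b c d r s) ha (by rw [dsc_tr, hdet]; simpa using hD)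
  rw [dsc_tr, hdet, one_pow, one_mul] at h1 h2
  simp only [dsc_tr, hes_tr, jac_tr, cub_tr, hdet, one_pow, one_mul] at h3
  have kd : 4*(α*s^2-β*s*n+γ*n^2)*(α*r^2-β*r*m+γ*m^2)
      -(-2*α*s*r+β*(s*m+r*n)-2*γ*n*m)^2 = (m*s-n*r)^2*(4*α*γ-β^2) := by ring
  rw [hdet, one_pow, one_mul] at kd
  refine ⟨α*s^2-β*s*n+γ*n^2, -2*α*s*r+β*(s*m+r*n)-2*γ*n*m, α*r^2-β*r*m+γ*m^2, ?_, ?_, ?_⟩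
  · rw [kd]; exact h1
  · rw [kd]; exact h2
  · intro x y
    have := h3 (s*x-r*y) (-n*x+m*y)
    have ex : m*(s*x-r*y)+r*(-n*x+m*y) = x := by linear_combination x*hdet
    have ey : n*(s*x-r*y)+s*(-n*x+m*y) = y := by linear_combination y*hdet
    rw [ex, ey] at this
    have eq : (α*s^2-β*s*n+γ*n^2)*x^2+(-2*α*s*r+β*(s*m+r*n)-2*γ*n*m)*x*y
       +(α*r^2-β*r*m+γ*m^2)*y^2
      = α*(s*x-r*y)^2+β*(s*x-r*y)*(-n*x+m*y)+γ*(-n*x+m*y)^2 := by ring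
    rw [eq]; exact this

lemma cub_cast (a b c d x y : ℤ) : ((cub a b c d x y : ℤ):ℝ) = cub (a:ℝ) b c d x y := by
  simp only [cub]; push_cast; ring
lemma hes_cast (a b c d x y : ℤ) : ((hes a b c d x y : ℤ):ℝ) = hes (a:ℝ) b c d x y := by
  simp only [hes]; push_cast; ring
lemma jac_cast (a b c d x y : ℤ) : ((jac a b c d x y : ℤ):ℝ) = jac (a:ℝ) b c d x y := by
  simp only [jac]; push_cast; ring
lemma dsc_cast (a b c d : ℤ) : ((dsc a b c d : ℤ):ℝ) = dsc (a:ℝ) b c d := by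
  simp only [dsc]; push_cast; ring

/-- data attached to a pair: the form `(a,b,c,d)` represents `p` at a primitive vector with the
prescribed covariants -/
def CRep (p : ℕ) (A B a b c d x y : ℤ) : Prop :=
  IsCoprime x y ∧ cub a b c d x y = p ∧ hes a b c d x y = -3*A ∧ jac a b c d x y = 27*B

lemma uniq (p : ℕ) (hp : 0 < p) (Z : ℝ) (hZ : 0 ≤ Z) (hpZ : 26*Z^2 < p)
    (a b c d A B A' B' x y x' y' : ℤ)
    (hD : dsc a b c d ≠ 0) (h : CRep p A B a b c d x y) (h' : CRep p A' B' a b c d x' y')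
    (hA : |(A:ℝ)| ≤ Z^2) (hB : |(B:ℝ)| ≤ Z^3) (hA' : |(A':ℝ)| ≤ Z^2) (hB' : |(B':ℝ)| ≤ Z^3)
    (hdvd : (p:ℤ) ∣ x*y'-y*x') : A = A' ∧ B = B' := by
  obtain ⟨⟨u, v, huv⟩, h1, h2, h3⟩ := h
  obtain ⟨_, h1', h2', h3'⟩ := h'
  have hpz : (p:ℤ) ≠ 0 := by exact_mod_cast hp.ne'
  have hDR : dsc (a:ℝ) b c d ≠ 0 := by rw [← dsc_cast]; exact_mod_cast hD
  have huvR : (x:ℝ)*u-y*(-v) = 1 := by exact_mod_cast (by linarith : x*u-y*(-v) = 1)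
  obtain ⟨α, β, γ, g1, g2, g3⟩ := QP_gen (a:ℝ) b c d x y (-v) u huvR
    (by rw [← cub_cast, h1]; exact_mod_cast hpz) hDR
  have bd : ∀ A B x y : ℤ, hes a b c d x y = -3*A → jac a b c d x y = 27*B →
      |(A:ℝ)| ≤ Z^2 → |(B:ℝ)| ≤ Z^3 → α*x^2+β*x*y+γ*y^2 ≤ 13*Z^2 := by
    intro A B x y e1 e2 k1 k2
    apply (g3 x y).2.2 Z hZ
    · rw [← hes_cast, e1]; push_cast; rw [abs_mul]; norm_num; exact k1
    · rw [← jac_cast, e2]; push_cast; rw [abs_mul]; norm_num; exact k2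
  have b1 := bd A B x y h2 h3 hA hB
  have b2 := bd A' B' x' y' h2' h3' hA' hB'
  have n1 : 0 ≤ α*(x:ℝ)^2+β*x*y+γ*y^2 := by
    have := (g3 x y).1; have := abs_nonneg (hes (a:ℝ) b c d x y); linarith
  have n2 : 0 ≤ α*(x':ℝ)^2+β*x'*y'+γ*y'^2 := by
    have := (g3 x' y').1; have := abs_nonneg (hes (a:ℝ) b c d x' y'); linarith
  have e1 : (1:ℝ) ≤ |dsc (a:ℝ) b c d| := by
    rw [← dsc_cast]; exact_mod_cast Int.one_le_abs hD
  have hδ : x*y'-y*x' = 0 := by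
    by_contra hne
    have k1 : (p:ℤ) ≤ |x*y'-y*x'| := Int.le_of_dvd (abs_pos.mpr hne) ((dvd_abs _ _).mpr hdvd)
    have k2 : (p:ℝ) ≤ |(x:ℝ)*y'-y*x'| := by exact_mod_cast k1
    have k3 : (p:ℝ)^2 ≤ ((x:ℝ)*y'-y*x')^2 := by rw [← sq_abs ((x:ℝ)*y'-y*x')]; gcongr
    have k4 : 4*(α*(x:ℝ)^2+β*x*y+γ*y^2)*(α*(x':ℝ)^2+β*x'*y'+γ*y'^2)
      = (2*α*x*x'+β*(x*y'+y*x')+2*γ*y*y')^2+(4*α*γ-β^2)*((x:ℝ)*y'-y*x')^2 := by ring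
    have k5 : 4*(α*(x:ℝ)^2+β*x*y+γ*y^2)*(α*(x':ℝ)^2+β*x'*y'+γ*y'^2) ≤ 4*(13*Z^2)*(13*Z^2) := by
      gcongr
    have k6 : 1*((x:ℝ)*y'-y*x')^2 ≤ (4*α*γ-β^2)*((x:ℝ)*y'-y*x')^2 := by gcongr; linarith
    have k7 : (p:ℝ)^2 ≤ (26*Z^2)^2 := by
      nlinarith [sq_nonneg (2*α*x*x'+β*(x*y'+y*x')+2*γ*y*y')]
    have k8 : (26*Z^2)^2 < (p:ℝ)^2 := by gcongr
    linarith
  -- parallel vectors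
  set l := u*x'+v*y' with hl
  have ex : x' = l*x := by rw [hl]; linear_combination (-x')*huv - v*hδ
  have ey : y' = l*y := by rw [hl]; linear_combination (-y')*huv + u*hδ
  have hl3 : l^3 = 1 := by
    have : cub a b c d x' y' = l^3*cub a b c d x y := by rw [ex, ey]; simp only [cub]; ring
    rw [h1, h1'] at this
    have h : (p:ℤ)*(l^3-1) = 0 := by linarith
    rcases mul_eq_zero.mp h with h | h
    · exact absurd h hpz
    · linarith
  have hl1 : l = 1 := by
    have : (l-1)*(l^2+l+1) = 0 := by linarith
    rcases mul_eq_zero.mp this with h | h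
    · linarith
    · nlinarith [sq_nonneg (2*l+1)]
  rw [hl1, one_mul] at ex ey
  rw [ex, ey] at h2' h3'
  constructor <;> linarith

lemma lift_root (p : ℕ) (hp : p.Prime) (hp5 : 5 ≤ p) (A B : ℤ) (hA : ¬ (p:ℤ) ∣ A)
    (hdvd : (p:ℤ)^2 ∣ 4*A^3+27*B^2) :
    ∃ t b c : ℤ, 3*t^2+A = p*b ∧ t^3+A*t+B = p^2*c := by
  have hpp : Prime (p:ℤ) := Nat.prime_iff_prime_int.mp hp
  have h2 : ¬ (p:ℤ) ∣ 2 := by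
    intro h; have := Int.le_of_dvd (by norm_num) h; omega
  have hc : IsCoprime (p:ℤ) (2*A) := by
    rw [Prime.coprime_iff_not_dvd hpp]
    intro h
    rcases hpp.dvd_or_dvd h with h | h
    · exact h2 h
    · exact hA h
  have hc2 : IsCoprime ((p:ℤ)^2) (2*A) := hc.pow_left
  obtain ⟨u, v, huv⟩ := hc2
  have hc2 : IsCoprime ((p:ℤ)^2) (2*A) := hc.pow_left
  obtain ⟨k, hk⟩ := hdvd
  set t := -3*B*v with ht
  have h2At : 2*A*t = -3*B+3*B*u*p^2 := by rw [ht]; linear_combination (-3*B)*huv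
  have d1 : (p:ℤ)^2 ∣ (2*A)^2*(3*t^2+A) := by
    refine ⟨k + 3*(-3*B)*(3*B*u)*2+3*(3*B*u)^2*p^2, ?_⟩
    linear_combination hk + 3*(2*A*t+(-3*B+3*B*u*p^2))*h2At
  have d2 : (p:ℤ)^2 ∣ (2*A)^3*(t^3+A*t+B) := by
    have e : (2*A)^3*(t^3+A*t+B) = (2*A*t)^3+4*A^3*(2*A*t)+8*A^3*B := by ring
    rw [e, h2At]
    refine ⟨-B*k + 3*9*B^2*(3*B*u)-3*3*B*(3*B*u)^2*p^2+(3*B*u)^3*p^4+4*A^3*(3*B*u), ?_⟩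
    linear_combination (-B)*hk
  have e1 := (hc2.pow_right (n := 2)).dvd_of_dvd_mul_left d1
  have e2 := (hc2.pow_right (n := 3)).dvd_of_dvd_mul_left d2
  obtain ⟨b, hb⟩ := e1
  obtain ⟨c, hc⟩ := e2
  exact ⟨t, p*b, c, by rw [hb]; ring, hc⟩

/-- the finite family of reduced forms -/
def Good (κ : ℝ) (a b c d : ℤ) : Prop :=
  (a ≠ 0 ∧ |(a:ℝ)| ≤ 5*κ ∧ 0 ≤ b ∧ b < |3*a| ∧ |(b:ℝ)^2-3*a*c| ≤ 6*κ^2 ∧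
    |2*(b:ℝ)^3-9*a*b*c+27*a^2*d| ≤ 42*κ^3) ∨
  (a = 0 ∧ b ≠ 0 ∧ (b:ℝ)^2 ≤ 6*κ^2 ∧ 0 ≤ c ∧ c < |2*b| ∧
    |(b:ℝ)^2*(c^2-4*b*d)| ≤ κ^4)

lemma small_vec (a b c d : ℤ) (ha : a ≠ 0) (hD : dsc a b c d ≠ 0) (κ : ℝ) (hκ : 0 ≤ κ)
    (hDκ : |(dsc a b c d : ℝ)| ≤ κ^4) :
    ∃ m n : ℤ, IsCoprime m n ∧ |cub (a:ℝ) b c d m n| ≤ 5*κ ∧ |hes (a:ℝ) b c d m n| ≤ 6*κ^2 ∧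
      |jac (a:ℝ) b c d m n| ≤ 42*κ^3 := by
  have hDR : dsc (a:ℝ) b c d ≠ 0 := by rw [← dsc_cast]; exact_mod_cast hD
  obtain ⟨α, β, γ, g1, g2, g3⟩ := QP_lead (a:ℝ) b c d (by exact_mod_cast ha) hDR
  have hpos : 0 < |dsc (a:ℝ) b c d| := abs_pos.mpr hDR
  have hα0 : 0 ≤ α := by
    have := (g3 1 0).1
    have h2 := abs_nonneg (hes (a:ℝ) b c d 1 0)
    norm_num at this; linarith
  have hα : 0 < α := by
    rcases hα0.eq_or_lt with h | h
    · rw [← h] at g1; nlinarith [sq_nonneg β]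
    · exact h
  obtain ⟨m, n, hmn, hQ⟩ := reduce α β γ hα (by linarith)
  refine ⟨m, n, hmn, ?_⟩
  obtain ⟨k1, k2, -⟩ := g3 m n
  have hs := syz (a:ℝ) b c d m n
  set Q := α*(m:ℝ)^2+β*m*n+γ*n^2
  set e := dsc (a:ℝ) b c d
  set H := hes (a:ℝ) b c d m n
  set J := jac (a:ℝ) b c d m n
  set F := cub (a:ℝ) b c d m n
  have hQ0 : 0 ≤ Q := by have := abs_nonneg H; linarith
  have hQe : Q^2 ≤ 3 * |e| := by linarith
  have hQκ : Q ≤ 2*κ^2 := by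
    apply le_of_sq_le_sq _ (by positivity)
    nlinarith [pow_nonneg hκ 4]
  refine ⟨?_, ?_, ?_⟩
  · apply abs_le_of_sq_le_sq _ (by positivity)
    have : F^2 ≤ 12*Q := by
      rcases hQ0.eq_or_lt with h | h
      · rw [← h] at k2 ⊢
        have : F^2 ≤ 0 := by
          by_contra hc
          push Not at hc
          have := mul_pos hpos hc
          norm_num at k2; linarith
        linarith
      · have h1 : Q^2*F^2 ≤ Q^2*(12*Q) := by
          have : Q^2*F^2 ≤ 3 * |e| * F^2 := by gcongr
          nlinarith
        exact le_of_mul_le_mul_left h1 (by positivity)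
    nlinarith [sq_nonneg κ]
  · linarith
  · apply abs_le_of_sq_le_sq _ (by positivity)
    have h1 : H^3 ≤ (3*Q)^3 := by
      have h2 : H^3 ≤ |H|^3 := by rw [← abs_pow]; exact le_abs_self _
      have h3 : |H|^3 ≤ (3*Q)^3 := by gcongr
      linarith
    have h2 : -(e*F^2) ≤ |e| * F^2 := by nlinarith [neg_abs_le e, sq_nonneg F]
    have h3 : Q^3 ≤ (2*κ^2)^3 := by gcongr
    nlinarith [pow_nonneg hκ 6]

lemma tb_shift (a b c d m n r s j : ℤ) :
    tb a b c d m n (r+j*m) (s+j*n) = tb a b c d m n r s + 3*cub a b c d m n*j := by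
  simp only [tb, cub]; ring

lemma tc_shift (a b c d m n r s j : ℤ) (h : cub a b c d m n = 0) :
    tb a b c d (r+j*m) (s+j*n) m n = tb a b c d r s m n + 2*tb a b c d m n r s*j := by
  have : tb a b c d (r+j*m) (s+j*n) m n = tb a b c d r s m n + 2*tb a b c d m n r s*j
      + 3*cub a b c d m n*j^2 := by
    simp only [tb, cub]; ring
  rw [this, h]; ring

lemma reduce_form (a b c d : ℤ) (ha : a ≠ 0) (hD : dsc a b c d ≠ 0) (κ : ℝ) (hκ : 0 ≤ κ)
    (hDκ : |(dsc a b c d : ℝ)| ≤ κ^4) :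
    ∃ m n r s : ℤ, m*s-n*r = 1 ∧ Good κ (cub a b c d m n) (tb a b c d m n r s)
      (tb a b c d r s m n) (cub a b c d r s) := by
  obtain ⟨m, n, ⟨s₀, r₀, h₀⟩, k1, k2, k3⟩ := small_vec a b c d ha hD κ hκ hDκ
  have hdet : ∀ j : ℤ, m*(s₀+j*n)-n*(-r₀+j*m) = 1 := by intro j; linarith
  have hdet' : ∀ r s : ℤ, m*s-n*r = 1 →
      |((tb a b c d m n r s : ℤ):ℝ)^2 - 3*(cub a b c d m n : ℤ)*(tb a b c d r s m n : ℤ)| ≤ 6*κ^2 ∧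
      |2*((tb a b c d m n r s : ℤ):ℝ)^3 - 9*(cub a b c d m n : ℤ)*(tb a b c d m n r s : ℤ)
        *(tb a b c d r s m n : ℤ) + 27*(cub a b c d m n : ℤ)^2*(cub a b c d r s : ℤ)| ≤ 42*κ^3 ∧
      |((dsc (cub a b c d m n) (tb a b c d m n r s) (tb a b c d r s m n) (cub a b c d r s) : ℤ):ℝ)|
        ≤ κ^4 := by
    intro r s h
    have e1 := hes_tr a b c d m n r s 1 0
    have e2 := jac_tr a b c d m n r s 1 0
    have e3 := dsc_tr a b c d m n r s
    simp only [h, one_pow, one_mul, mul_one, mul_zero, add_zero] at e1 e2 e3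
    rw [e3, dsc_cast]
    rw [← hes_cast, ← e1] at k2
    rw [← jac_cast, ← e2] at k3
    refine ⟨?_, ?_, hDκ⟩
    · convert k2 using 2
      simp only [hes]; push_cast; ring
    · convert k3 using 2
      simp only [jac]; push_cast; ring
  rw [← cub_cast] at k1
  by_cases hz : cub a b c d m n = 0
  · set b0 := tb a b c d m n (-r₀) s₀ with hb0
    set c0 := tb a b c d (-r₀) s₀ m n with hc0
    have hb : b0 ≠ 0 := by
      intro hb
      have e3 := dsc_tr a b c d m n (-r₀) s₀
      rw [show m*s₀-n*(-r₀) = 1 by linarith, ← hb0, hb, hz] at e3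
      apply hD
      rw [one_pow, one_mul] at e3
      rw [← e3]; simp [dsc]
    refine ⟨m, n, -r₀+(-(c0/(2*b0)))*m, s₀+(-(c0/(2*b0)))*n, hdet _, Or.inr ?_⟩
    have h3 := hdet' _ _ (hdet (-(c0/(2*b0))))
    have eb := tb_shift a b c d m n (-r₀) s₀ (-(c0/(2*b0)))
    have ec := tc_shift a b c d m n (-r₀) s₀ (-(c0/(2*b0))) hz
    rw [← hb0, hz, mul_zero, zero_mul, add_zero] at eb
    have hc' : tb a b c d (-r₀+(-(c0/(2*b0)))*m) (s₀+(-(c0/(2*b0)))*n) m n = c0 % (2*b0) := by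
      rw [ec, ← hb0, ← hc0, Int.emod_def]; ring
    rw [eb, hc', hz] at h3
    rw [eb, hc']
    refine ⟨hz, hb, ?_, Int.emod_nonneg _ (by omega), Int.emod_lt_abs _ (by omega), ?_⟩
    · have := h3.1
      norm_num at this
      exact this
    · convert h3.2.2 using 2
      simp only [dsc]; push_cast; ring
  · set b0 := tb a b c d m n (-r₀) s₀ with hb0
    set a0 := cub a b c d m n with ha0
    refine ⟨m, n, -r₀+(-(b0/(3*a0)))*m, s₀+(-(b0/(3*a0)))*n, hdet _, Or.inl ?_⟩
    have h3 := hdet' _ _ (hdet (-(b0/(3*a0))))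
    have hb' : tb a b c d m n (-r₀+(-(b0/(3*a0)))*m) (s₀+(-(b0/(3*a0)))*n) = b0 % (3*a0) := by
      rw [tb_shift, ← hb0, ← ha0, Int.emod_def]; ring
    refine ⟨hz, k1, ?_, ?_, h3.1, h3.2.1⟩
    · rw [hb']; exact Int.emod_nonneg _ (by omega)
    · rw [hb']; exact Int.emod_lt_abs _ (by omega)

lemma exist_rep (p : ℕ) (hp : p.Prime) (hp5 : 5 ≤ p) (A B : ℤ) (hA : ¬ (p:ℤ) ∣ A)
    (hdvd : (p:ℤ)^2 ∣ 4*A^3+27*B^2) (hD : 4*A^3+27*B^2 ≠ 0) (κ : ℝ) (hκ : 0 ≤ κ)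
    (hDκ : |(4*(A:ℝ)^3+27*B^2)| ≤ κ^4*p^2) :
    ∃ a b c d x y : ℤ, CRep p A B a b c d x y ∧ dsc a b c d ≠ 0 ∧ Good κ a b c d := by
  obtain ⟨t, b₀, c₀, hb, hc⟩ := lift_root p hp hp5 A B hA hdvd
  have hpz : (p:ℤ) ≠ 0 := by exact_mod_cast hp.ne_zero
  have hAe : A = p*b₀-3*t^2 := by linarith
  have hBe : B = p^2*c₀-t^3-A*t := by linarith
  have ed : (p:ℤ)^2*dsc (p:ℤ) (3*t) b₀ c₀ = -(4*A^3+27*B^2) := by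
    rw [hBe, hAe]; simp only [dsc]; ring
  have hD0 : dsc (p:ℤ) (3*t) b₀ c₀ ≠ 0 := by
    intro h; rw [h] at ed; apply hD; linarith
  have hh : hes (p:ℤ) (3*t) b₀ c₀ 1 0 = -3*A := by
    rw [hAe]; simp only [hes]; ring
  have hj : jac (p:ℤ) (3*t) b₀ c₀ 1 0 = 27*B := by
    rw [hBe, hAe]; simp only [jac]; ring
  have hf : cub (p:ℤ) (3*t) b₀ c₀ 1 0 = p := by
    simp only [cub]; ring
  have hDκ' : |((dsc (p:ℤ) (3*t) b₀ c₀ : ℤ):ℝ)| ≤ κ^4 := by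
    have hpp : (0:ℝ) < (p:ℝ)^2 := by have := hp.pos; positivity
    have e2 : (p:ℝ)^2*((dsc (p:ℤ) (3*t) b₀ c₀ : ℤ):ℝ) = -(4*(A:ℝ)^3+27*B^2) := by
      exact_mod_cast ed
    have : (p:ℝ)^2 * |((dsc (p:ℤ) (3*t) b₀ c₀ : ℤ):ℝ)| = |(4*(A:ℝ)^3+27*B^2)| := by
      rw [← abs_neg (4*(A:ℝ)^3+27*B^2), ← e2, abs_mul, abs_of_pos hpp]
    have h : (p:ℝ)^2 * |((dsc (p:ℤ) (3*t) b₀ c₀ : ℤ):ℝ)| ≤ (p:ℝ)^2*κ^4 := by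
      rw [this]; linarith
    exact le_of_mul_le_mul_left h hpp
  rw [dsc_cast] at hDκ'
  obtain ⟨m, n, r, s, hdet, hG⟩ := reduce_form (p:ℤ) (3*t) b₀ c₀ hpz hD0 κ hκ hDκ'
  refine ⟨_, _, _, _, s, -n, ⟨⟨m, r, by linarith⟩, ?_, ?_, ?_⟩, ?_, hG⟩
  · rw [cub_tr, show m*s+r*(-n) = 1 by linarith, show n*s+s*(-n) = 0 by ring, hf]
  · rw [hes_tr, hdet, show m*s+r*(-n) = 1 by linarith, show n*s+s*(-n) = 0 by ring, hh]; ring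
  · rw [jac_tr, hdet, show m*s+r*(-n) = 1 by linarith, show n*s+s*(-n) = 0 by ring, hj]; ring
  · rw [dsc_tr, hdet, one_pow, one_mul]; exact hD0

/-- integers within `ρ` of `u` -/
noncomputable def II (u ρ : ℝ) : Finset ℤ := Finset.Icc ⌈u-ρ⌉ ⌊u+ρ⌋

lemma mem_II (u ρ : ℝ) (x : ℤ) : x ∈ II u ρ ↔ |(x:ℝ)-u| ≤ ρ := by
  rw [II, Finset.mem_Icc, Int.ceil_le, Int.le_floor, abs_le]
  constructor <;> rintro ⟨h1, h2⟩ <;> constructor <;> linarith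

lemma card_II (u ρ : ℝ) (hρ : 0 ≤ ρ) : ((II u ρ).card : ℝ) ≤ 2*ρ+1 := by
  rw [II, Int.card_Icc]
  have h1 := Int.floor_le (u+ρ)
  have h2 := Int.le_ceil (u-ρ)
  have h3 : (((⌊u+ρ⌋+1-⌈u-ρ⌉).toNat : ℤ):ℝ) = ((max (⌊u+ρ⌋+1-⌈u-ρ⌉) 0 : ℤ):ℝ) := by
    rw [Int.toNat_eq_max]
  have h4 : (((⌊u+ρ⌋+1-⌈u-ρ⌉).toNat : ℤ):ℝ) = ((⌊u+ρ⌋+1-⌈u-ρ⌉).toNat : ℝ) := by norm_cast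
  rw [← h4, h3]
  push_cast
  apply max_le <;> linarith

lemma sum_sq (N : ℕ) : ∑ i ∈ Finset.range N, (1:ℝ)/((i:ℝ)+1)^2 ≤ 2 - 1/(N:ℝ) := by
  induction N with
  | zero => norm_num
  | succ n ih =>
    rw [Finset.sum_range_succ]
    rcases Nat.eq_zero_or_pos n with h | h
    · subst h; norm_num
    · have hn : (0:ℝ) < n := by exact_mod_cast h
      have : (1:ℝ)/((n:ℝ)+1)^2 ≤ 1/(n:ℝ) - 1/((n:ℝ)+1) := by
        rw [div_sub_div _ _ (by positivity) (by positivity), div_le_div_iff₀ (by positivity) (by positivity)]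
        nlinarith
      push_cast
      linarith

lemma sum_sq_int (s : Finset ℤ) (hs : (0:ℤ) ∉ s) : ∑ a ∈ s, (1:ℝ)/(a:ℝ)^2 ≤ 4 := by
  classical
  set N := s.sup Int.natAbs with hN
  set P := (Finset.range N).image (fun i : ℕ => (i:ℤ)+1)
  set M := (Finset.range N).image (fun i : ℕ => -((i:ℤ)+1))
  have hsub : s ⊆ P ∪ M := by
    intro a ha
    have h1 : a.natAbs ≤ N := Finset.le_sup (f := Int.natAbs) ha
    have h0 : a ≠ 0 := fun h => hs (h ▸ ha)
    rw [Finset.mem_union, Finset.mem_image, Finset.mem_image]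
    rcases lt_or_gt_of_ne h0 with h | h
    · right; exact ⟨a.natAbs - 1, by rw [Finset.mem_range]; omega, by omega⟩
    · left; exact ⟨a.natAbs - 1, by rw [Finset.mem_range]; omega, by omega⟩
  have hP : ∑ a ∈ P, (1:ℝ)/(a:ℝ)^2 ≤ 2 := by
    rw [Finset.sum_image (by intro a _ b _ h; simpa using h)]
    have := sum_sq N
    have h2 : (0:ℝ) ≤ 1/(N:ℝ) := by positivity
    push_cast; linarith
  have hM : ∑ a ∈ M, (1:ℝ)/(a:ℝ)^2 ≤ 2 := by
    rw [Finset.sum_image (by intro a _ b _ h; simpa using h)]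
    have := sum_sq N
    have h2 : (0:ℝ) ≤ 1/(N:ℝ) := by positivity
    push_cast; simp only [neg_add_rev]
    have e : ∀ i : ℕ, (-1 + -(i:ℝ))^2 = ((i:ℝ)+1)^2 := by intro i; ring
    simp only [e]; linarith
  have h1 : ∑ a ∈ s, (1:ℝ)/(a:ℝ)^2 ≤ ∑ a ∈ P ∪ M, (1:ℝ)/(a:ℝ)^2 :=
    Finset.sum_le_sum_of_subset_of_nonneg hsub (fun _ _ _ => by positivity)
  have h2 := Finset.sum_union_inter (s₁ := P) (s₂ := M) (f := fun a : ℤ => (1:ℝ)/(a:ℝ)^2)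
  have h3 : 0 ≤ ∑ a ∈ P ∩ M, (1:ℝ)/(a:ℝ)^2 := Finset.sum_nonneg (fun _ _ => by positivity)
  linarith

lemma good_count (κ : ℝ) (hκ : 1 ≤ κ) : ∃ S : Finset (ℤ × ℤ × ℤ × ℤ),
    (∀ a b c d, Good κ a b c d → (a, b, c, d) ∈ S) ∧ (S.card : ℝ) ≤ 4000*κ^5 := by
  classical
  have hκ0 : 0 < κ := by linarith
  have p2 : 1 ≤ κ^2 := one_le_pow₀ hκ
  have p3 : 1 ≤ κ^3 := one_le_pow₀ hκ
  have p12 : κ ≤ κ^2 := by nlinarith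
  have p23 : κ^2 ≤ κ^3 := by nlinarith
  set Sa := (II 0 (5*κ)).erase 0 with hSa
  set S1 := Sa.sigma (fun a => (Finset.Ico (0:ℤ) |3*a|).sigma (fun b =>
    (II ((b:ℝ)^2/(3*a)) (2*κ^2/|(a:ℝ)|)).sigma (fun c =>
      II ((9*a*b*c-2*(b:ℝ)^3)/(27*a^2)) (14/9*κ^3/(a:ℝ)^2)))) with hS1
  set Sb := (II 0 (3*κ)).erase 0 with hSb
  set S2 := Sb.sigma (fun b => (Finset.Ico (0:ℤ) |2*b|).sigma (fun c =>
      II ((c:ℝ)^2/(4*b)) (κ^4/(4 * |(b:ℝ)|^3)))) with hS2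
  have card1 : (S1.card : ℝ) ≤ 3500*κ^5 := by
    rw [hS1, Finset.card_sigma]
    push_cast
    have inner : ∀ a ∈ Sa, ((((Finset.Ico (0:ℤ) |3*a|).sigma (fun b =>
      (II ((b:ℝ)^2/(3*a)) (2*κ^2/|(a:ℝ)|)).sigma (fun c =>
      II ((9*a*b*c-2*(b:ℝ)^3)/(27*a^2)) (14/9*κ^3/(a:ℝ)^2)))).card : ℕ) : ℝ)
        ≤ 783*κ^5*(1/(a:ℝ)^2) := by
      intro a ha
      rw [hSa, Finset.mem_erase, mem_II, sub_zero] at ha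
      obtain ⟨ha0, ha⟩ := ha
      have haR : (0:ℝ) < |(a:ℝ)| := abs_pos.mpr (by exact_mod_cast ha0)
      have hsq : |(a:ℝ)|^2 = (a:ℝ)^2 := sq_abs _
      have ha2 : (0:ℝ) < (a:ℝ)^2 := by rw [← hsq]; positivity
      have ha25 : (a:ℝ)^2 ≤ 25*κ^3 := by
        have : |(a:ℝ)|^2 ≤ (5*κ)^2 := by gcongr
        nlinarith
      rw [Finset.card_sigma]; push_cast
      have cd : ∀ (b c : ℤ), ((II ((9*a*b*c-2*(b:ℝ)^3)/(27*a^2)) (14/9*κ^3/(a:ℝ)^2)).card:ℝ)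
          ≤ 29*κ^3/(a:ℝ)^2 := by
        intro b c
        refine (card_II _ _ (by positivity)).trans ?_
        rw [le_div_iff₀ ha2, add_mul, mul_assoc, div_mul_cancel₀ _ ha2.ne']
        linarith
      have cc : ∀ b : ℤ, ((((II ((b:ℝ)^2/(3*a)) (2*κ^2/|(a:ℝ)|)).sigma (fun c =>
          II ((9*a*b*c-2*(b:ℝ)^3)/(27*a^2)) (14/9*κ^3/(a:ℝ)^2))).card : ℕ):ℝ)
          ≤ 9*κ^2/|(a:ℝ)| * (29*κ^3/(a:ℝ)^2) := by
        intro b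
        rw [Finset.card_sigma]; push_cast
        refine (Finset.sum_le_card_nsmul _ _ _ (fun c _ => cd b c)).trans ?_
        rw [nsmul_eq_mul]
        gcongr
        refine (card_II _ _ (by positivity)).trans ?_
        rw [le_div_iff₀ haR, add_mul, mul_assoc, div_mul_cancel₀ _ haR.ne']
        linarith
      refine (Finset.sum_le_card_nsmul _ _ _ (fun b _ => cc b)).trans ?_
      rw [nsmul_eq_mul, Int.card_Ico]
      have : (((|3*a|-0).toNat : ℕ):ℝ) = 3 * |(a:ℝ)| := by
        have h : (((|3*a|-0).toNat : ℕ):ℤ) = 3 * |a| := by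
          rw [sub_zero, Int.toNat_of_nonneg (abs_nonneg _), abs_mul]; rfl
        exact_mod_cast h
      rw [this]
      apply le_of_eq
      field_simp
      ring
    refine (Finset.sum_le_sum inner).trans ?_
    rw [← Finset.mul_sum]
    have := sum_sq_int Sa (by simp [hSa])
    have h5 : 0 < κ^5 := by positivity
    nlinarith
  have card2 : (S2.card : ℝ) ≤ 49*κ^5 := by
    rw [hS2, Finset.card_sigma]
    push_cast
    have inner : ∀ b ∈ Sb, ((((Finset.Ico (0:ℤ) |2*b|).sigma (fun c =>
      II ((c:ℝ)^2/(4*b)) (κ^4/(4 * |(b:ℝ)|^3)))).card : ℕ) : ℝ) ≤ 7*κ^4 := by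
      intro b hb
      rw [hSb, Finset.mem_erase, mem_II, sub_zero] at hb
      obtain ⟨hb0, hb⟩ := hb
      have hbR : (1:ℝ) ≤ |(b:ℝ)| := by exact_mod_cast Int.one_le_abs hb0
      rw [Finset.card_sigma]; push_cast
      refine (Finset.sum_le_card_nsmul _ _ _ (fun c _ => card_II _ _ (by positivity))).trans ?_
      rw [nsmul_eq_mul, Int.card_Ico]
      have : (((|2*b|-0).toNat : ℕ):ℝ) = 2 * |(b:ℝ)| := by
        have h : (((|2*b|-0).toNat : ℕ):ℤ) = 2 * |b| := by
          rw [sub_zero, Int.toNat_of_nonneg (abs_nonneg _), abs_mul]; rfl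
        exact_mod_cast h
      rw [this]
      set β := |(b:ℝ)|
      have e : 2*β*(2*(κ^4/(4*β^3))+1) = κ^4/β^2+2*β := by field_simp; ring
      rw [e]
      have h1 : κ^4/β^2 ≤ κ^4 := div_le_self (by positivity) (one_le_pow₀ hbR)
      have h2 : κ ≤ κ^4 := le_self_pow₀ hκ (by norm_num)
      linarith
    refine (Finset.sum_le_card_nsmul _ _ _ inner).trans ?_
    rw [nsmul_eq_mul]
    have h1 : (Sb.card:ℝ) ≤ 7*κ := by
      have h1 : (Sb.card:ℝ) ≤ (II 0 (3*κ)).card := by exact_mod_cast Finset.card_erase_le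
      have h2 := card_II 0 (3*κ) (by positivity)
      linarith
    calc (Sb.card:ℝ)*(7*κ^4) ≤ 7*κ*(7*κ^4) := by gcongr
      _ = 49*κ^5 := by ring
  refine ⟨S1.image (fun g => (g.1, g.2.1, g.2.2.1, g.2.2.2)) ∪
    S2.image (fun g => ((0:ℤ), g.1, g.2.1, g.2.2)), ?_, ?_⟩
  · intro a b c d h
    rw [Finset.mem_union, Finset.mem_image, Finset.mem_image]
    rcases h with ⟨ha, h1, h2, h3, h4, h5⟩ | ⟨rfl, hb, h1, h2, h3, h4⟩
    · left
      refine ⟨⟨a, b, c, d⟩, ?_, rfl⟩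
      have haR : (a:ℝ) ≠ 0 := by exact_mod_cast ha
      have haR' : (0:ℝ) < |(a:ℝ)| := abs_pos.mpr haR
      simp only [hS1, hSa, Finset.mem_sigma, Finset.mem_erase, mem_II, Finset.mem_Ico, sub_zero]
      refine ⟨⟨ha, h1⟩, ⟨h2, h3⟩, ?_, ?_⟩
      · have e : (c:ℝ)-(b:ℝ)^2/(3*a) = -(((b:ℝ)^2-3*a*c)/(3*a)) := by field_simp; ring
        rw [e, abs_neg, abs_div, abs_mul, abs_of_pos (by norm_num : (0:ℝ)<3),
          div_le_div_iff₀ (by positivity) haR']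
        nlinarith
      · have e : (d:ℝ)-(9*a*b*c-2*(b:ℝ)^3)/(27*a^2)
          = (2*(b:ℝ)^3-9*a*b*c+27*a^2*d)/(27*a^2) := by field_simp; ring
        have ha2 : (0:ℝ) < (a:ℝ)^2 := by positivity
        rw [e, abs_div, abs_of_pos (by positivity : (0:ℝ)<27*a^2),
          div_le_div_iff₀ (by positivity) ha2]
        nlinarith
    · right
      refine ⟨⟨b, c, d⟩, ?_, rfl⟩
      have hbR : (b:ℝ) ≠ 0 := by exact_mod_cast hb
      have hbR' : (0:ℝ) < |(b:ℝ)| := abs_pos.mpr hbR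
      simp only [hS2, hSb, Finset.mem_sigma, Finset.mem_erase, mem_II, Finset.mem_Ico, sub_zero]
      refine ⟨⟨hb, ?_⟩, ⟨h2, h3⟩, ?_⟩
      · apply abs_le_of_sq_le_sq _ (by positivity)
        nlinarith
      · have e : (d:ℝ)-(c:ℝ)^2/(4*b) = -(((b:ℝ)^2*(c^2-4*b*d))/(4*b^3)) := by field_simp; ring
        rw [e, abs_neg, abs_div, abs_mul 4, abs_pow (b:ℝ) 3, abs_of_pos (by norm_num : (0:ℝ)<4)]
        gcongr
  · have h1 : ((S1.image (fun g => (g.1, g.2.1, g.2.2.1, g.2.2.2)) ∪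
      S2.image (fun g => ((0:ℤ), g.1, g.2.1, g.2.2))).card : ℝ) ≤ S1.card + S2.card := by
      exact_mod_cast (Finset.card_union_le _ _).trans
        (add_le_add Finset.card_image_le Finset.card_image_le)
    have h5 : 0 < κ^5 := by positivity
    linarith

lemma cubic_coeffs {F : Type*} [Field F] (α β γ δ : F)
    (h : Polynomial.C α * Polynomial.X^3 + Polynomial.C β * Polynomial.X^2
      + Polynomial.C γ * Polynomial.X + Polynomial.C δ = 0) : α = 0 ∧ β = 0 ∧ γ = 0 ∧ δ = 0 := by
  refine ⟨?_, ?_, ?_, ?_⟩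
  · have := congrArg (fun q => Polynomial.coeff q 3) h
    simpa [Polynomial.coeff_X, Polynomial.coeff_C] using this
  · have := congrArg (fun q => Polynomial.coeff q 2) h
    simpa [Polynomial.coeff_X, Polynomial.coeff_C] using this
  · have := congrArg (fun q => Polynomial.coeff q 1) h
    simpa [Polynomial.coeff_X, Polynomial.coeff_C] using this
  · have := congrArg (fun q => Polynomial.coeff q 0) h
    simpa [Polynomial.coeff_X, Polynomial.coeff_C] using this

lemma fiber4 (p : ℕ) (hp : p.Prime) (hp5 : 5 ≤ p) (Z : ℝ) (hZ : 0 ≤ Z) (hpZ : 26*Z^2 < p)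
    (a b c d : ℤ) (hD : dsc a b c d ≠ 0) (T : Finset (ℤ × ℤ))
    (hT : ∀ t ∈ T, ¬ (p:ℤ) ∣ t.1 ∧ |(t.1:ℝ)| ≤ Z^2 ∧ |(t.2:ℝ)| ≤ Z^3 ∧
      ∃ x y, CRep p t.1 t.2 a b c d x y) : T.card ≤ 4 := by
  classical
  haveI : Fact p.Prime := ⟨hp⟩
  rcases T.eq_empty_or_nonempty with h | ⟨t₀, ht₀⟩
  · rw [h]; simp
  have hx : ∀ t : ℤ × ℤ, ∃ v : ℤ × ℤ, t ∈ T → CRep p t.1 t.2 a b c d v.1 v.2 := by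
    intro t
    by_cases ht : t ∈ T
    · obtain ⟨x, y, h⟩ := (hT t ht).2.2.2
      exact ⟨(x, y), fun _ => h⟩
    · exact ⟨(0, 0), fun h => absurd h ht⟩
  choose v hv using hx
  set P : Polynomial (ZMod p) := Polynomial.C (a : ZMod p) * Polynomial.X^3
    + Polynomial.C (b : ZMod p) * Polynomial.X^2 + Polynomial.C (c : ZMod p) * Polynomial.X
    + Polynomial.C (d : ZMod p) with hP
  have hdeg : P.natDegree ≤ 3 := by rw [hP]; compute_degree
  have hP0 : P ≠ 0 := by
    intro h0
    obtain ⟨c3, c2, c1, c0⟩ := cubic_coeffs _ _ _ _ (hP.symm.trans h0)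
    have hh := (hv t₀ ht₀).2.2.1
    have h3 : (((-3*t₀.1 : ℤ)) : ZMod p) = 0 := by
      rw [← hh]; simp only [hes]; push_cast; rw [c3, c2, c1, c0]; ring
    rw [ZMod.intCast_zmod_eq_zero_iff_dvd] at h3
    have hpp : Prime (p:ℤ) := Nat.prime_iff_prime_int.mp hp
    rcases hpp.dvd_or_dvd h3 with h | h
    · have := Int.le_of_dvd (by norm_num) ((dvd_neg).mpr h); omega
    · exact (hT t₀ ht₀).1 h
  set φ : ℤ × ℤ → Option (ZMod p) := fun t =>
    if ((v t).2 : ZMod p) = 0 then none else some ((v t).1 / (v t).2) with hφ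
  have hmaps : ∀ t ∈ T, φ t ∈ insert none (P.roots.toFinset.image some) := by
    intro t ht
    simp only [hφ]
    split_ifs with h
    · simp
    · rw [Finset.mem_insert]
      right
      rw [Finset.mem_image]
      refine ⟨_, ?_, rfl⟩
      rw [Multiset.mem_toFinset, Polynomial.mem_roots hP0, Polynomial.IsRoot.def]
      have hc := (hv t ht).2.1
      have hc' : ((cub a b c d (v t).1 (v t).2 : ℤ) : ZMod p) = 0 := by rw [hc]; simp
      simp only [cub] at hc'
      push_cast at hc'
      simp only [hP, Polynomial.eval_add, Polynomial.eval_mul, Polynomial.eval_C,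
        Polynomial.eval_pow, Polynomial.eval_X]
      field_simp
      linear_combination hc'
  have hinj : Set.InjOn φ T := by
    intro t ht t' ht' h
    have hd : (p:ℤ) ∣ (v t).1*(v t').2 - (v t).2*(v t').1 := by
      rw [← ZMod.intCast_zmod_eq_zero_iff_dvd]
      push_cast
      simp only [hφ] at h
      split_ifs at h with h1 h2 h2
      · rw [h1, h2]; ring
      · have := Option.some.inj h
        rw [div_eq_div_iff h1 h2] at this
        linear_combination this
    obtain ⟨_, k1, k2, _⟩ := hT t ht
    obtain ⟨_, k1', k2', _⟩ := hT t' ht'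
    have := uniq p hp.pos Z hZ hpZ a b c d _ _ _ _ _ _ _ _ hD (hv t ht) (hv t' ht') k1 k2 k1' k2' hd
    exact Prod.ext this.1 this.2
  calc T.card ≤ (insert none (P.roots.toFinset.image some)).card :=
        Finset.card_le_card_of_injOn φ hmaps hinj
    _ ≤ (P.roots.toFinset.image some).card + 1 := Finset.card_insert_le _ _
    _ ≤ P.roots.toFinset.card + 1 := by gcongr; exact Finset.card_image_le
    _ ≤ Multiset.card P.roots + 1 := by gcongr; exact Multiset.toFinset_card_le _
    _ ≤ 4 := by have := Polynomial.card_roots' P; omega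

lemma case3 (p : ℕ) (hp : p.Prime) (hp5 : 5 ≤ p) (Z : ℝ) (hZ : 0 ≤ Z) (hpZ : 26*Z^2 < p)
    (κ : ℝ) (hκ : 1 ≤ κ) (hκZ : 2*Z^6 ≤ κ^4*p^2) (T : Finset (ℤ × ℤ))
    (hT : ∀ t ∈ T, ¬ (p:ℤ) ∣ t.1 ∧ |(t.1:ℝ)| ≤ Z^2 ∧ |(t.2:ℝ)| ≤ Z^3 ∧
      (p:ℤ)^2 ∣ 4*t.1^3+27*t.2^2 ∧ 4*t.1^3+27*t.2^2 ≠ 0 ∧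
      |4*(t.1:ℝ)^3+27*t.2^2| ≤ 2*Z^6) : (T.card:ℝ) ≤ 16000*κ^5 := by
  classical
  obtain ⟨S, hS, hcard⟩ := good_count κ hκ
  have hg : ∀ t : ℤ × ℤ, ∃ g : ℤ × ℤ × ℤ × ℤ, t ∈ T → g ∈ S ∧ dsc g.1 g.2.1 g.2.2.1 g.2.2.2 ≠ 0 ∧
      ∃ x y, CRep p t.1 t.2 g.1 g.2.1 g.2.2.1 g.2.2.2 x y := by
    intro t
    by_cases ht : t ∈ T
    · obtain ⟨h1, h2, h3, h4, h5, h6⟩ := hT t ht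
      obtain ⟨a, b, c, d, x, y, hr, hd, hG⟩ :=
        exist_rep p hp hp5 t.1 t.2 h1 h4 h5 κ (by linarith) (by linarith)
      exact ⟨(a, b, c, d), fun _ => ⟨hS a b c d hG, hd, x, y, hr⟩⟩
    · exact ⟨0, fun h => absurd h ht⟩
  choose g hg using hg
  have key : T.card ≤ 4 * S.card := by
    apply Finset.card_le_mul_card_image_of_maps_to (f := g) (fun t ht => (hg t ht).1)
    intro s hs
    rcases (T.filter (fun t => g t = s)).eq_empty_or_nonempty with h | ⟨t₀, ht₀⟩
    · rw [h]; simp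
    rw [Finset.mem_filter] at ht₀
    have hd := (hg t₀ ht₀.1).2.1
    rw [ht₀.2] at hd
    apply fiber4 p hp hp5 Z hZ hpZ _ _ _ _ hd
    intro t ht
    rw [Finset.mem_filter] at ht
    obtain ⟨h1, h2, h3, _⟩ := hT t ht.1
    have := (hg t ht.1).2.2
    rw [ht.2] at this
    exact ⟨h1, h2, h3, this⟩
  have : (T.card:ℝ) ≤ 4*S.card := by exact_mod_cast key
  linarith

lemma cnt_mod (M : ℤ) (hM : 0 < M) (L : ℝ) (hL : 0 ≤ L) (B₀ : ℤ) (U : Finset ℤ)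
    (hU : ∀ x ∈ U, |(x:ℝ)| ≤ L ∧ M ∣ x - B₀) : (U.card:ℝ) ≤ 2*(L/M)+1 := by
  classical
  have hMR : (0:ℝ) < M := by exact_mod_cast hM
  refine le_trans (Nat.cast_le.mpr ?_) (card_II (-(B₀:ℝ)/M) (L/M) (by positivity))
  apply Finset.card_le_card_of_injOn (fun x => (x-B₀)/M)
  · intro x hx
    obtain ⟨h1, k, hk⟩ := hU x hx
    simp only [Finset.mem_coe]
    rw [mem_II, hk, Int.mul_ediv_cancel_left _ hM.ne']
    have hkR : (x:ℝ)-B₀ = M*k := by exact_mod_cast hk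
    have : (k:ℝ) - -(B₀:ℝ)/M = x/M := by field_simp; linarith
    rw [this, abs_div, abs_of_pos hMR]; gcongr
  · intro x hx y hy h
    obtain ⟨h1, k, hk⟩ := hU x hx
    obtain ⟨h1, l, hl⟩ := hU y hy
    simp only [hk, hl, Int.mul_ediv_cancel_left _ hM.ne'] at h
    rw [h] at hk; linarith

lemma case2 (p : ℕ) (hp : p.Prime) (hp5 : 5 ≤ p) (Z : ℝ) (hZ : 0 ≤ Z) (T : Finset (ℤ × ℤ))
    (hT : ∀ t ∈ T, ¬ (p:ℤ) ∣ t.1 ∧ |(t.1:ℝ)| ≤ Z^2 ∧ |(t.2:ℝ)| ≤ Z^3 ∧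
      (p:ℤ)^2 ∣ 4*t.1^3+27*t.2^2) : (T.card:ℝ) ≤ (2*Z^2+1)*(2*(2*(Z^3/p^2)+1)) := by
  classical
  have hpp : Prime (p:ℤ) := Nat.prime_iff_prime_int.mp hp
  have hp0 : (0:ℤ) < (p:ℤ)^2 := by have := hp.pos; positivity
  have sm : ∀ k : ℤ, 0 < k → k < 5 → ¬ (p:ℤ) ∣ k := by
    intro k h1 h2 h; have := Int.le_of_dvd h1 h; omega
  have n27 : ¬ (p:ℤ) ∣ 27 := by
    intro h
    rw [show (27:ℤ) = 3^3 by norm_num] at h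
    exact sm 3 (by norm_num) (by norm_num) (hpp.dvd_of_dvd_pow h)
  have hmaps : ∀ t ∈ T, t.1 ∈ II 0 (Z^2) := by
    intro t ht; rw [mem_II, sub_zero]; exact (hT t ht).2.1
  rw [Finset.card_eq_sum_card_fiberwise hmaps]
  push_cast
  have fib : ∀ A ∈ II 0 (Z^2), (((T.filter (fun t => t.1 = A)).card : ℕ):ℝ)
      ≤ 2*(2*(Z^3/p^2)+1) := by
    intro A _
    rcases (T.filter (fun t => t.1 = A)).eq_empty_or_nonempty with h | ⟨t₀, ht₀⟩
    · rw [h]; simp; positivity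
    rw [Finset.mem_filter] at ht₀
    set U := (T.filter (fun t => t.1 = A)).image Prod.snd with hUdef
    have hcU : (T.filter (fun t => t.1 = A)).card = U.card := by
      rw [hUdef, Finset.card_image_of_injOn]
      intro t ht t' ht' h
      simp only [Finset.coe_filter, Set.mem_ofPred_eq] at ht ht'
      exact Prod.ext (ht.2.trans ht'.2.symm) h
    obtain ⟨hA, _, _, hd₀⟩ := hT t₀ ht₀.1
    have hB₀ : ¬ (p:ℤ) ∣ t₀.2 := by
      intro h
      have h1 : (p:ℤ) ∣ 4*t₀.1^3 := by
        have h2 : (p:ℤ) ∣ 4*t₀.1^3+27*t₀.2^2 := (dvd_pow_self _ (by norm_num)).trans hd₀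
        have h3 : (p:ℤ) ∣ 27*t₀.2^2 := (h.trans (dvd_pow_self _ (by norm_num))).mul_left _
        exact (dvd_add_left h3).mp h2
      rcases hpp.dvd_or_dvd h1 with h | h
      · exact sm 4 (by norm_num) (by norm_num) h
      · exact hA (hpp.dvd_of_dvd_pow h)
    have hU : ∀ x ∈ U, |(x:ℝ)| ≤ Z^3 ∧ ((p:ℤ)^2 ∣ x - t₀.2 ∨ (p:ℤ)^2 ∣ x - (-t₀.2)) := by
      intro x hx
      rw [hUdef, Finset.mem_image] at hx
      obtain ⟨t, ht, rfl⟩ := hx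
      rw [Finset.mem_filter] at ht
      obtain ⟨_, _, h3, h4⟩ := hT t ht.1
      refine ⟨h3, ?_⟩
      have h5 : (p:ℤ)^2 ∣ 27*((t.2-t₀.2)*(t.2+t₀.2)) := by
        have e : 27*((t.2-t₀.2)*(t.2+t₀.2))
            = (4*t.1^3+27*t.2^2)-(4*t₀.1^3+27*t₀.2^2) := by rw [ht.2, ht₀.2]; ring
        rw [e]; exact dvd_sub h4 hd₀
      have h6 : (p:ℤ)^2 ∣ (t.2-t₀.2)*(t.2+t₀.2) :=
        (((Prime.coprime_iff_not_dvd hpp).mpr n27).pow_left (m := 2)).dvd_of_dvd_mul_left h5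
      rw [sub_neg_eq_add]
      by_cases hs : (p:ℤ) ∣ t.2-t₀.2
      · left
        have : ¬ (p:ℤ) ∣ t.2+t₀.2 := by
          intro h
          have h7 := dvd_sub h hs
          rw [show t.2+t₀.2-(t.2-t₀.2) = 2*t₀.2 by ring] at h7
          rcases hpp.dvd_or_dvd h7 with h | h
          · exact sm 2 (by norm_num) (by norm_num) h
          · exact hB₀ h
        exact (((Prime.coprime_iff_not_dvd hpp).mpr this).pow_left (m := 2)).dvd_of_dvd_mul_right h6
      · right
        exact (((Prime.coprime_iff_not_dvd hpp).mpr hs).pow_left (m := 2)).dvd_of_dvd_mul_left h6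
    rw [hcU]
    have hsub : U ⊆ U.filter (fun x => (p:ℤ)^2 ∣ x - t₀.2) ∪ U.filter (fun x => (p:ℤ)^2 ∣ x - (-t₀.2)) := by
      intro x hx
      rw [Finset.mem_union, Finset.mem_filter, Finset.mem_filter]
      rcases (hU x hx).2 with h | h
      · exact Or.inl ⟨hx, h⟩
      · exact Or.inr ⟨hx, h⟩
    have h1 := (Finset.card_le_card hsub).trans (Finset.card_union_le _ _)
    have h2 := cnt_mod ((p:ℤ)^2) hp0 (Z^3) (by positivity) t₀.2
      (U.filter (fun x => (p:ℤ)^2 ∣ x - t₀.2))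
      (fun x hx => by rw [Finset.mem_filter] at hx; exact ⟨(hU x hx.1).1, hx.2⟩)
    have h3 := cnt_mod ((p:ℤ)^2) hp0 (Z^3) (by positivity) (-t₀.2)
      (U.filter (fun x => (p:ℤ)^2 ∣ x - (-t₀.2)))
      (fun x hx => by rw [Finset.mem_filter] at hx; exact ⟨(hU x hx.1).1, hx.2⟩)
    have h4 : (U.card:ℝ) ≤ (U.filter (fun x => (p:ℤ)^2 ∣ x - t₀.2)).card
      + (U.filter (fun x => (p:ℤ)^2 ∣ x - (-t₀.2))).card := by exact_mod_cast h1
    push_cast at h2 h3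
    linarith
  refine (Finset.sum_le_card_nsmul _ _ _ fib).trans ?_
  rw [nsmul_eq_mul]
  gcongr
  exact card_II _ _ (by positivity)

lemma case1 (p : ℕ) (hp : 0 < p) (Z : ℝ) (hZ : 0 ≤ Z) (T : Finset (ℤ × ℤ))
    (hT : ∀ t ∈ T, (p:ℤ) ∣ t.1 ∧ (p:ℤ) ∣ t.2 ∧ |(t.1:ℝ)| ≤ Z^2 ∧ |(t.2:ℝ)| ≤ Z^3) :
    (T.card:ℝ) ≤ (2*(Z^2/p)+1)*(2*(Z^3/p)+1) := by
  classical
  have hpR : (0:ℝ) < p := by exact_mod_cast hp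
  have hpz : (p:ℤ) ≠ 0 := by exact_mod_cast hp.ne'
  have h1 : T.card ≤ (II 0 (Z^2/p) ×ˢ II 0 (Z^3/p)).card := by
    apply Finset.card_le_card_of_injOn (fun t => (t.1/(p:ℤ), t.2/(p:ℤ)))
    · intro t ht
      obtain ⟨⟨k, hk⟩, ⟨l, hl⟩, h3, h4⟩ := hT t ht
      rw [hk] at h3; rw [hl] at h4
      push_cast at h3 h4
      rw [abs_mul, abs_of_pos hpR] at h3 h4
      simp only [Finset.mem_coe, Finset.mem_product, mem_II, sub_zero]
      rw [hk, hl, Int.mul_ediv_cancel_left _ hpz, Int.mul_ediv_cancel_left _ hpz,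
        le_div_iff₀ hpR, le_div_iff₀ hpR]
      constructor <;> linarith
    · intro t ht t' ht' h
      obtain ⟨⟨k, hk⟩, ⟨l, hl⟩, _⟩ := hT t ht
      obtain ⟨⟨k', hk'⟩, ⟨l', hl'⟩, _⟩ := hT t' ht'
      simp only [hk, hl, hk', hl', Int.mul_ediv_cancel_left _ hpz, Prod.mk.injEq] at h
      apply Prod.ext
      · rw [hk, hk', h.1]
      · rw [hl, hl', h.2]
  rw [Finset.card_product] at h1
  have h2 : (T.card:ℝ) ≤ (II 0 (Z^2/p)).card * (II 0 (Z^3/p)).card := by exact_mod_cast h1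
  refine h2.trans ?_
  gcongr
  · exact card_II _ _ (by positivity)
  · exact card_II _ _ (by positivity)

lemma main_count (p : ℕ) (hp : p.Prime) (σ ρ Z : ℝ) (hσ : 1 ≤ σ) (hρ : 1 ≤ ρ) (hZ : Z = σ^2)
    (hpρ : (p:ℝ) = ρ^6) (T : Finset (ℤ × ℤ))
    (hT : ∀ t ∈ T, |(t.1:ℝ)| ≤ Z^2 ∧ |(t.2:ℝ)| ≤ Z^3 ∧
      (p:ℤ)^2 ∣ -16*(4*t.1^3+27*t.2^2) ∧ 4*t.1^3+27*t.2^2 ≠ 0 ∧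
      |4*(t.1:ℝ)^3+27*t.2^2| ≤ 2*Z^6) : (T.card:ℝ) ≤ 1000000*σ^10/ρ^8 := by
  classical
  have hσ0 : 0 < σ := by linarith
  have hρ0 : 0 < ρ := by linarith
  have hZ1 : 1 ≤ Z := by rw [hZ]; exact one_le_pow₀ hσ
  have hZ0 : 0 < Z := by linarith
  have hZ2 : 1 ≤ Z^2 := one_le_pow₀ hZ1
  have hZ3 : 1 ≤ Z^3 := one_le_pow₀ hZ1
  have hp0 : (0:ℝ) < p := by exact_mod_cast hp.pos
  have hZ5 : σ^10 = Z^5 := by rw [hZ]; ring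
  rw [hZ5]
  have hρ8 : 0 < ρ^8 := by positivity
  rcases lt_or_ge p 5 with hp5 | hp5
  · have h1 := case1 1 one_pos Z hZ0.le T (fun t ht => ⟨by simp, by simp, (hT t ht).1, (hT t ht).2.1⟩)
    simp only [Nat.cast_one, div_one] at h1
    have h2 : (p:ℝ) ≤ 5 := by exact_mod_cast hp5.le
    have h3 : ρ^8 ≤ 25 := by
      calc ρ^8 ≤ ρ^12 := pow_le_pow_right₀ hρ (by norm_num)
        _ = (p:ℝ)^2 := by rw [hpρ]; ring
        _ ≤ 5^2 := by gcongr
        _ = 25 := by norm_num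
    rw [le_div_iff₀ hρ8]
    have h4 : (2*Z^2+1)*(2*Z^3+1) ≤ (3*Z^2)*(3*Z^3) := by gcongr <;> linarith
    calc (T.card:ℝ)*ρ^8 ≤ ((3*Z^2)*(3*Z^3))*25 := by
          gcongr; linarith
      _ = 225*Z^5 := by ring
      _ ≤ 1000000*Z^5 := by gcongr; norm_num
  have hpp : Prime (p:ℤ) := Nat.prime_iff_prime_int.mp hp
  have sm : ∀ k : ℤ, 0 < k → k < 5 → ¬ (p:ℤ) ∣ k := by
    intro k h1 h2 h; have := Int.le_of_dvd h1 h; omega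
  have n27 : ¬ (p:ℤ) ∣ 27 := by
    intro h
    rw [show (27:ℤ) = 3^3 by norm_num] at h
    exact sm 3 (by norm_num) (by norm_num) (hpp.dvd_of_dvd_pow h)
  have n16 : ¬ (p:ℤ) ∣ -16 := by
    intro h
    rw [dvd_neg, show (16:ℤ) = 2^4 by norm_num] at h
    exact sm 2 (by norm_num) (by norm_num) (hpp.dvd_of_dvd_pow h)
  have hdv : ∀ t ∈ T, (p:ℤ)^2 ∣ 4*t.1^3+27*t.2^2 := by
    intro t ht
    exact (((Prime.coprime_iff_not_dvd hpp).mpr n16).pow_left (m := 2)).dvd_of_dvd_mul_left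
      (hT t ht).2.2.1
  -- split
  have hsplit := Finset.card_filter_add_card_filter_not (s := T) (fun t => (p:ℤ) ∣ t.1)
  set T1 := T.filter (fun t => (p:ℤ) ∣ t.1) with hT1
  set T2 := T.filter (fun t => ¬ (p:ℤ) ∣ t.1) with hT2
  have hsum : (T.card:ℝ) = T1.card + T2.card := by exact_mod_cast hsplit.symm
  have m1 : ∀ t ∈ T1, (p:ℤ) ∣ t.1 ∧ (p:ℤ) ∣ t.2 ∧ |(t.1:ℝ)| ≤ Z^2 ∧ |(t.2:ℝ)| ≤ Z^3 := by
    intro t ht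
    rw [hT1, Finset.mem_filter] at ht
    refine ⟨ht.2, ?_, (hT t ht.1).1, (hT t ht.1).2.1⟩
    have h2 : (p:ℤ) ∣ 4*t.1^3+27*t.2^2 := (dvd_pow_self _ (by norm_num)).trans (hdv t ht.1)
    have h3 : (p:ℤ) ∣ 4*t.1^3 := (ht.2.trans (dvd_pow_self _ (by norm_num))).mul_left _
    have h4 := (dvd_add_right h3).mp h2
    rcases hpp.dvd_or_dvd h4 with h | h
    · exact absurd h n27
    · exact hpp.dvd_of_dvd_pow h
  have b1 : (T1.card:ℝ)*ρ^8 ≤ 9*Z^5 := by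
    have h1 := case1 p hp.pos Z hZ0.le T1 m1
    rcases le_or_gt (p:ℝ) (Z^2) with h | h
    · have q1 : 1 ≤ Z^2/p := by rw [le_div_iff₀ hp0]; linarith
      have q2 : 1 ≤ Z^3/p := by
        rw [le_div_iff₀ hp0]
        have : Z^2 ≤ Z^3 := pow_le_pow_right₀ hZ1 (by norm_num)
        linarith
      calc (T1.card:ℝ)*ρ^8 ≤ ((3*(Z^2/p))*(3*(Z^3/p)))*ρ^12 := by
            gcongr
            · refine h1.trans ?_
              gcongr <;> linarith
            · norm_num
        _ = 9*Z^5 := by rw [hpρ]; field_simp; ring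
    · rcases T1.eq_empty_or_nonempty with h0 | ⟨t, ht⟩
      · rw [h0]; simp; positivity
      obtain ⟨a1, a2, a3, a4⟩ := m1 t ht
      have hA : t.1 = 0 := by
        apply Int.eq_zero_of_abs_lt_dvd a1
        have : |(t.1:ℝ)| < p := by linarith
        exact_mod_cast this
      have hB : t.2 ≠ 0 := by
        intro hB
        rw [hT1, Finset.mem_filter] at ht
        exact (hT t ht.1).2.2.2.1 (by rw [hA, hB]; norm_num)
      have hpB : (p:ℝ) ≤ |(t.2:ℝ)| := by
        have := Int.le_of_dvd (abs_pos.mpr hB) ((dvd_abs _ _).mpr a2)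
        exact_mod_cast this
      have hpZ : (p:ℝ) ≤ Z^3 := hpB.trans a4
      have hρZ : ρ^2 ≤ Z := by
        apply le_of_pow_le_pow_left₀ (n := 3) (by norm_num) hZ0.le
        calc (ρ^2)^3 = p := by rw [hpρ]; ring
          _ ≤ Z^3 := hpZ
      have q1 : Z^2/p ≤ 1 := by rw [div_le_iff₀ hp0]; linarith
      have q2 : 1 ≤ Z^3/p := by rw [le_div_iff₀ hp0]; linarith
      calc (T1.card:ℝ)*ρ^8 ≤ ((3*1)*(3*(Z^3/p)))*ρ^8 := by
            gcongr
            refine h1.trans ?_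
            gcongr <;> linarith
        _ = 9*Z^3*ρ^2 := by rw [hpρ]; field_simp; ring
        _ ≤ 9*Z^3*Z^2 := by
            have : ρ^2 ≤ Z^2 := hρZ.trans (by nlinarith)
            exact mul_le_mul_of_nonneg_left this (by positivity)
        _ = 9*Z^5 := by ring
  have b2 : (T2.card:ℝ)*ρ^8 ≤ 512000*Z^5 := by
    have m2 : ∀ t ∈ T2, t ∈ T ∧ ¬ (p:ℤ) ∣ t.1 := by
      intro t ht
      rw [hT2, Finset.mem_filter] at ht
      exact ht
    rcases le_or_gt ((p:ℝ)^4) (1000000*Z^9) with h | h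
    · have h1 := case2 p hp hp5 Z hZ0.le T2 (fun t ht => ⟨(m2 t ht).2, (hT t (m2 t ht).1).1,
        (hT t (m2 t ht).1).2.1, hdv t (m2 t ht).1⟩)
      have h2 : ρ^8 ≤ 100*Z^3 := by
        apply le_of_pow_le_pow_left₀ (n := 3) (by norm_num) (by positivity)
        calc (ρ^8)^3 = (p:ℝ)^4 := by rw [hpρ]; ring
          _ ≤ 1000000*Z^9 := h
          _ = (100*Z^3)^3 := by ring
      calc (T2.card:ℝ)*ρ^8 ≤ ((3*Z^2)*(2*(2*(Z^3/p^2)+1)))*ρ^8 := by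
            gcongr
            refine h1.trans ?_
            gcongr
            linarith
        _ = 12*(Z^5/p^2)*ρ^8 + 6*Z^2*ρ^8 := by ring
        _ ≤ 12*(Z^5/p^2)*ρ^12 + 6*Z^2*(100*Z^3) := by
            gcongr
            · norm_num
        _ = 612*Z^5 := by rw [hpρ]; field_simp; ring
        _ ≤ 512000*Z^5 := by gcongr; norm_num
    · rcases T2.eq_empty_or_nonempty with h0 | ⟨t, ht⟩
      · rw [h0]; simp; positivity
      have hpZ : 26*Z^2 < p := by
        apply lt_of_pow_lt_pow_left₀ 4 hp0.le
        calc (26*Z^2)^4 = 456976*Z^8 := by ring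
          _ ≤ 1000000*Z^9 := by
            gcongr
            · norm_num
            · norm_num
          _ < (p:ℝ)^4 := h
      have hκe : (2*σ^3/ρ^3)^4 = 16*(Z^6/(p:ℝ)^2) := by
        rw [hpρ, hZ]; field_simp; ring
      have hpD : (p:ℝ)^2 ≤ 2*Z^6 := by
        obtain ⟨c1, c2⟩ := m2 t ht
        obtain ⟨_, _, _, d1, d2⟩ := hT t c1
        have := Int.le_of_dvd (abs_pos.mpr d1) ((dvd_abs _ _).mpr (hdv t c1))
        have h3 : (p:ℝ)^2 ≤ |4*(t.1:ℝ)^3+27*t.2^2| := by exact_mod_cast this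
        linarith
      have hκ : 1 ≤ 2*σ^3/ρ^3 := by
        apply le_of_pow_le_pow_left₀ (n := 4) (by norm_num) (by positivity)
        rw [hκe, one_pow]
        have : 1/2 ≤ Z^6/(p:ℝ)^2 := by rw [le_div_iff₀ (by positivity)]; linarith
        linarith
      have h1 := case3 p hp hp5 Z hZ0.le hpZ (2*σ^3/ρ^3) hκ (by
        rw [hκe]
        have : 16*(Z^6/(p:ℝ)^2)*(p:ℝ)^2 = 16*Z^6 := by field_simp
        rw [this]
        have : 0 < Z^6 := by positivity
        linarith) T2 (fun t ht => ⟨(m2 t ht).2, (hT t (m2 t ht).1).1,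
        (hT t (m2 t ht).1).2.1, hdv t (m2 t ht).1, (hT t (m2 t ht).1).2.2.2⟩)
      have hσρ : σ^3 ≤ ρ^4 := by
        apply le_of_pow_le_pow_left₀ (n := 6) (by norm_num) (by positivity)
        calc (σ^3)^6 = Z^9 := by rw [hZ]; ring
          _ ≤ 1000000*Z^9 := by
            have : 0 < Z^9 := by positivity
            linarith
          _ ≤ (p:ℝ)^4 := h.le
          _ = (ρ^4)^6 := by rw [hpρ]; ring
      have hσρ' : σ^5 ≤ ρ^7 := by
        apply le_of_pow_le_pow_left₀ (n := 3) (by norm_num) (by positivity)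
        calc (σ^5)^3 = (σ^3)^5 := by ring
          _ ≤ (ρ^4)^5 := by gcongr
          _ = ρ^20 := by ring
          _ ≤ ρ^21 := pow_le_pow_right₀ hρ (by norm_num)
          _ = (ρ^7)^3 := by ring
      calc (T2.card:ℝ)*ρ^8 ≤ (16000*(2*σ^3/ρ^3)^5)*ρ^8 := by gcongr
        _ = 512000*σ^10*(σ^5/ρ^7) := by field_simp; ring
        _ ≤ 512000*σ^10*1 := by
            gcongr
            rw [div_le_one (by positivity)]; exact hσρ'
        _ = 512000*Z^5 := by rw [hZ]; ring
  rw [le_div_iff₀ hρ8, hsum, add_mul]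
  have : 0 < Z^5 := by positivity
  linarith

/-- There is a constant `C` such that for every prime `p` and every `X ≥ 1`, the number of
elliptic curves `E_{A,B} : y² = x³ + Ax + B` over `ℚ` (in reduced form) of height `< X`
whose discriminant `−16(4A³ + 27B²)` is divisible by `p²` is at most `C·X^{5/6}/p^{4/3}`. -/
theorem stmt17 :
    ∃ C : ℝ, ∀ p : ℕ, p.Prime → ∀ X : ℝ, 1 ≤ X →
      (Set.ncard {ab : ℤ × ℤ |
          4 * ab.1 ^ 3 + 27 * ab.2 ^ 2 ≠ 0 ∧
          (∀ q : ℕ, q.Prime → ¬ ((q : ℤ) ^ 4 ∣ ab.1 ∧ (q : ℤ) ^ 6 ∣ ab.2)) ∧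
          ((max (4 * |ab.1| ^ 3) (27 * ab.2 ^ 2) : ℤ) : ℝ) < X ∧
          (p : ℤ) ^ 2 ∣ (-16 * (4 * ab.1 ^ 3 + 27 * ab.2 ^ 2))} : ℝ)
        ≤ C * X ^ ((5 : ℝ)/6) / (p : ℝ) ^ ((4 : ℝ)/3) := by
  refine ⟨1000000, fun p hp X hX => ?_⟩
  have hX0 : 0 ≤ X := by linarith
  have hp0 : (0:ℝ) ≤ p := by positivity
  have hp1 : (1:ℝ) ≤ p := by exact_mod_cast hp.one_lt.le
  have e1 : X ^ ((5 : ℝ)/6) = (X^((1:ℝ)/12))^10 := by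
    rw [← Real.rpow_natCast, ← Real.rpow_mul hX0]; norm_num
  have e2 : (p:ℝ) ^ ((4 : ℝ)/3) = ((p:ℝ)^((1:ℝ)/6))^8 := by
    rw [← Real.rpow_natCast, ← Real.rpow_mul hp0]; norm_num
  have e3 : X = (X^((1:ℝ)/12))^12 := by
    rw [← Real.rpow_natCast, ← Real.rpow_mul hX0]; norm_num
  have e4 : (p:ℝ) = ((p:ℝ)^((1:ℝ)/6))^6 := by
    rw [← Real.rpow_natCast, ← Real.rpow_mul hp0]; norm_num
  have hσ : 1 ≤ X^((1:ℝ)/12) := Real.one_le_rpow hX (by norm_num)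
  have hρ : 1 ≤ (p:ℝ)^((1:ℝ)/6) := Real.one_le_rpow hp1 (by norm_num)
  rw [e1, e2]
  generalize X^((1:ℝ)/12) = σ at *
  generalize (p:ℝ)^((1:ℝ)/6) = ρ at *
  rcases Set.finite_or_infinite {ab : ℤ × ℤ |
          4 * ab.1 ^ 3 + 27 * ab.2 ^ 2 ≠ 0 ∧
          (∀ q : ℕ, q.Prime → ¬ ((q : ℤ) ^ 4 ∣ ab.1 ∧ (q : ℤ) ^ 6 ∣ ab.2)) ∧
          ((max (4 * |ab.1| ^ 3) (27 * ab.2 ^ 2) : ℤ) : ℝ) < X ∧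
          (p : ℤ) ^ 2 ∣ (-16 * (4 * ab.1 ^ 3 + 27 * ab.2 ^ 2))} with hf | hf
  swap
  · rw [hf.ncard]; push_cast; positivity
  rw [Set.ncard_eq_toFinset_card _ hf]
  apply main_count p hp σ ρ (σ^2) hσ hρ rfl e4
  intro t ht
  rw [Set.Finite.mem_toFinset] at ht
  obtain ⟨h1, _, h2, h3⟩ := ht
  push_cast at h2
  rw [max_lt_iff] at h2
  obtain ⟨h4, h5⟩ := h2
  have hXZ : X = (σ^2)^6 := by rw [e3]; ring
  rw [hXZ] at h4 h5
  have hZ0 : 0 ≤ σ^2 := by positivity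
  generalize σ^2 = Z at *
  have n0 : 0 ≤ |(t.1:ℝ)|^3 := by positivity
  have n1 : 0 ≤ (t.2:ℝ)^2 := by positivity
  refine ⟨?_, ?_, h3, h1, ?_⟩
  · apply le_of_pow_le_pow_left₀ (n := 3) (by norm_num) (by positivity)
    calc |(t.1:ℝ)|^3 ≤ Z^6 := by linarith
      _ = (Z^2)^3 := by ring
  · apply le_of_pow_le_pow_left₀ (n := 2) (by norm_num) (by positivity)
    calc |(t.2:ℝ)|^2 = (t.2:ℝ)^2 := sq_abs _
      _ ≤ Z^6 := by linarith
      _ = (Z^3)^2 := by ring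
  · calc |4*(t.1:ℝ)^3+27*t.2^2| ≤ |4*(t.1:ℝ)^3| + |27*(t.2:ℝ)^2| := abs_add_le _ _
      _ = 4*|(t.1:ℝ)|^3 + 27*(t.2:ℝ)^2 := by
          rw [abs_mul, abs_pow, abs_of_nonneg (a := 27*(t.2:ℝ)^2) (by positivity)]; norm_num
      _ ≤ 2*Z^6 := by linarith
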